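/- Assume in addition that α > 3, the step-size is constant s_k ≡ s ∈ (0, 1/L], β_k ≡ β = η √s/2 for some η ∈ (0,1], and Assumption (J0) holds. Then k² (f(x_k) − min f) → 0 as k → ∞; that is, f(x_k) − min f = o(1/k²). -/

import Mathlib

set_option autoImplicit false

open Filter

/-- A Robbins–Siegmund type lemma. -/
theorem summable_and_tendsto_of_le_add_mul_one_add {a p ε : ℕ → ℝ} {N : ℕ}
    (ha : ∀ n, 0 ≤ a n) (hp : ∀ n, 0 ≤ p n) (hε : ∀ n, 0 ≤ ε n) (hs : Summable ε)
    (h : ∀ n, N ≤ n → a (n + 1) + p n ≤ a n + ε n * (1 + a n)) :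
    Summable p ∧ ∃ l, Tendsto a atTop (nhds l) := by
  wlog hN : N = 0 generalizing a p ε N
  · have := this (a := fun n => a (n + N)) (p := fun n => p (n + N)) (ε := fun n => ε (n + N))
      (N := 0) (fun n => ha _) (fun n => hp _) (fun n => hε _) ((summable_nat_add_iff N).2 hs)
      (fun n _ => by
        have := h (n + N) (by lia)
        rwa [show n + N + 1 = n + 1 + N by ring] at this) rfl
    obtain ⟨h1, l, h2⟩ := this
    exact ⟨(summable_nat_add_iff N).1 h1, l, (tendsto_add_atTop_iff_nat N).1 h2⟩
  subst hN
  have hsum : ∀ n, ∑ j ∈ Finset.range n, ε j ≤ ∑' j, ε j := fun n =>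
    hs.sum_le_tsum _ (fun j _ => hε j)
  have hexp : ∀ n, 1 + a n ≤ Real.exp (∑ j ∈ Finset.range n, ε j) * (1 + a 0) := by
    intro n
    induction n with
    | zero => simp
    | succ n ih =>
      rw [Finset.sum_range_succ, Real.exp_add]
      have h1 := h n (Nat.zero_le _)
      have h2 := hp n
      have h3 : ε n + 1 ≤ Real.exp (ε n) := Real.add_one_le_exp _
      calc 1 + a (n + 1) ≤ (ε n + 1) * (1 + a n) := by linarith
        _ ≤ Real.exp (ε n) * (Real.exp (∑ j ∈ Finset.range n, ε j) * (1 + a 0)) :=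
          mul_le_mul h3 ih (by linarith [ha n]) (Real.exp_pos _).le
        _ = _ := by ring
  set B := Real.exp (∑' j, ε j) * (1 + a 0) with hB
  have hbd : ∀ n, 1 + a n ≤ B := fun n => (hexp n).trans <|
    mul_le_mul_of_nonneg_right (Real.exp_le_exp.2 (hsum n)) (by linarith [ha 0])
  have hB0 : 0 ≤ B := by linarith [hbd 0, ha 0]
  have hstep : ∀ n, a (n + 1) + p n ≤ a n + ε n * B := fun n =>
    (h n (Nat.zero_le _)).trans (by gcongr; exacts [hε n, hbd n])
  constructor
  · refine summable_of_sum_range_le (c := a 0 + (∑' j, ε j) * B) hp fun n => ?_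
    have : ∀ n, ∑ j ∈ Finset.range n, p j + a n ≤ a 0 + (∑ j ∈ Finset.range n, ε j) * B := by
      intro n
      induction n with
      | zero => simp
      | succ n ih =>
        rw [Finset.sum_range_succ, Finset.sum_range_succ]
        linarith [hstep n]
    have h2 := mul_le_mul_of_nonneg_right (hsum n) hB0
    linarith [this n, ha n]
  · have hanti : Antitone fun n => a n - (∑ j ∈ Finset.range n, ε j) * B := by
      refine antitone_nat_of_succ_le fun n => ?_
      rw [Finset.sum_range_succ]
      linarith [hstep n, hp n]
    have hbdd : BddBelow (Set.range fun n => a n - (∑ j ∈ Finset.range n, ε j) * B) := by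
      refine ⟨-((∑' j, ε j) * B), ?_⟩
      rintro _ ⟨n, rfl⟩
      have h2 := mul_le_mul_of_nonneg_right (hsum n) hB0
      dsimp only
      linarith [ha n]
    have h1 := tendsto_atTop_ciInf hanti hbdd
    have h2 := (hs.hasSum.tendsto_sum_nat).mul_const B
    refine ⟨_, (h1.add h2).congr fun n => ?_⟩
    ring

section

variable {H : Type*} [NormedAddCommGroup H] [InnerProductSpace ℝ H]

theorem hasDerivAt_comp_line [CompleteSpace H] {f : H → ℝ} {f' : H → H}
    (hdiff : ∀ z, HasGradientAt f (f' z) z) (z d : H) (t : ℝ) :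
    HasDerivAt (fun t : ℝ => f (z + t • d)) (inner ℝ (f' (z + t • d)) d) t := by
  have h1 : HasDerivAt (fun t : ℝ => z + t • d) d t := by
    simpa using ((hasDerivAt_id t).smul_const d).const_add z
  exact (hdiff (z + t • d)).hasFDerivAt.comp_hasDerivAt t h1

theorem ConvexOn.add_inner_gradient_le [CompleteSpace H] {f : H → ℝ} {f' : H → H}
    (hconv : ConvexOn ℝ Set.univ f) (hdiff : ∀ z, HasGradientAt f (f' z) z) (z w : H) :
    f z + inner ℝ (f' z) (w - z) ≤ f w := by
  have hc : ConvexOn ℝ Set.univ (fun t : ℝ => f (z + t • (w - z))) := by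
    have := hconv.comp_affineMap (AffineMap.lineMap z w)
    refine (this.congr ?_)
    intro t _
    simp [AffineMap.lineMap_apply, add_comm]
  have hd := hasDerivAt_comp_line hdiff z (w - z) 0
  have := hc.le_slope_of_hasDerivAt (Set.mem_univ 0) (Set.mem_univ 1) one_pos hd
  simp [slope_def_field] at this
  linarith

theorem le_add_inner_gradient_add_sq [CompleteSpace H] {f : H → ℝ} {f' : H → H} {L : ℝ}
    (hdiff : ∀ z, HasGradientAt f (f' z) z)
    (hlip : ∀ z w, ‖f' z - f' w‖ ≤ L * ‖z - w‖) (z w : H) :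
    f w ≤ f z + inner ℝ (f' z) (w - z) + L / 2 * ‖w - z‖ ^ 2 := by
  set d := w - z with hd
  have hder : ∀ t : ℝ, HasDerivAt
      (fun t : ℝ => f (z + t • d) - t * inner ℝ (f' z) d - L / 2 * ‖d‖ ^ 2 * t ^ 2)
      (inner ℝ (f' (z + t • d)) d - inner ℝ (f' z) d - L / 2 * ‖d‖ ^ 2 * (2 * t)) t := by
    intro t
    have h1 := (hasDerivAt_id t).mul_const (inner ℝ (f' z) d)
    have h2 := (hasDerivAt_pow 2 t).const_mul (L / 2 * ‖d‖ ^ 2)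
    exact (((hasDerivAt_comp_line hdiff z d t).sub h1).sub h2).congr_deriv (by simp)
  have hanti : AntitoneOn
      (fun t : ℝ => f (z + t • d) - t * inner ℝ (f' z) d - L / 2 * ‖d‖ ^ 2 * t ^ 2)
      (Set.Ici 0) := by
    refine antitoneOn_of_deriv_nonpos (convex_Ici 0)
      (fun t _ => (hder t).continuousAt.continuousWithinAt)
      (fun t _ => (hder t).differentiableAt.differentiableWithinAt) fun t ht => ?_
    rw [interior_Ici] at ht
    have ht : 0 < t := ht
    rw [(hder t).deriv, ← inner_sub_left]
    have h1 := real_inner_le_norm (f' (z + t • d) - f' z) d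
    have h2 := hlip (z + t • d) z
    rw [add_sub_cancel_left, norm_smul, Real.norm_of_nonneg ht.le] at h2
    have h3 := mul_le_mul_of_nonneg_right h2 (norm_nonneg d)
    linarith
  have := hanti (Set.mem_Ici.2 le_rfl) (Set.mem_Ici.2 zero_le_one) zero_le_one
  simp [hd] at this
  linarith

/-- Convexity inequality sharpened by the cocoercivity of the gradient. -/
theorem ConvexOn.le_add_inner_gradient_sub_sq [CompleteSpace H] {f : H → ℝ} {f' : H → H} {L : ℝ}
    (hL : 0 < L) (hconv : ConvexOn ℝ Set.univ f) (hdiff : ∀ z, HasGradientAt f (f' z) z)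
    (hlip : ∀ z w, ‖f' z - f' w‖ ≤ L * ‖z - w‖) (x y : H) :
    f y ≤ f x + inner ℝ (f' y) (y - x) - 1 / (2 * L) * ‖f' y - f' x‖ ^ 2 := by
  set u := f' y - f' x with hu
  have h1 := hconv.add_inner_gradient_le hdiff y (x + L⁻¹ • u)
  have h2 := le_add_inner_gradient_add_sq hdiff hlip x (x + L⁻¹ • u)
  rw [add_sub_cancel_left, norm_smul, Real.norm_of_nonneg (inv_pos.2 hL).le, inner_smul_right]
    at h2
  rw [show x + L⁻¹ • u - y = L⁻¹ • u - (y - x) by abel, inner_sub_right, inner_smul_right] at h1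
  have h3 : inner ℝ (f' y) u - inner ℝ (f' x) u = ‖u‖ ^ 2 := by
    rw [← inner_sub_left, ← hu, real_inner_self_eq_norm_sq]
  have h4 : L⁻¹ * inner ℝ (f' y) u - L⁻¹ * inner ℝ (f' x) u = L⁻¹ * ‖u‖ ^ 2 := by
    rw [← mul_sub, h3]
  have h5 : L / 2 * (L⁻¹ * ‖u‖) ^ 2 = L⁻¹ / 2 * ‖u‖ ^ 2 := by field_simp
  have h6 : 1 / (2 * L) * ‖u‖ ^ 2 = L⁻¹ / 2 * ‖u‖ ^ 2 := by field_simp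
  rw [h6]
  linarith

/-- Descent inequality for an inexact gradient step. -/
theorem ConvexOn.inexact_gradient_step_le [CompleteSpace H] {f : H → ℝ} {f' : H → H} {L s : ℝ}
    (hL : 0 < L) (hs : 0 < s) (hsL : s ≤ 1 / L)
    (hconv : ConvexOn ℝ Set.univ f) (hdiff : ∀ z, HasGradientAt f (f' z) z)
    (hlip : ∀ z w, ‖f' z - f' w‖ ≤ L * ‖z - w‖) (x y M : H) :
    f (y - s • (f' y + M)) ≤ f x + inner ℝ (f' y) (y - x) - s / 2 * ‖f' y‖ ^ 2
      - s / 2 * ‖f' y - f' x‖ ^ 2 + s / 2 * ‖M‖ ^ 2 := by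
  have h1 := le_add_inner_gradient_add_sq hdiff hlip y (y - s • (f' y + M))
  have h2 := hconv.le_add_inner_gradient_sub_sq hL hdiff hlip x y
  rw [sub_sub_cancel_left, norm_neg, norm_smul, Real.norm_of_nonneg hs.le, inner_neg_right,
    inner_smul_right, inner_add_right, real_inner_self_eq_norm_sq] at h1
  have h3 := norm_add_sq_real (f' y) M
  have hLs : L * s ≤ 1 := by rwa [le_div_iff₀ hL, mul_comm] at hsL
  have h4 : L / 2 * (s * ‖f' y + M‖) ^ 2 ≤ s / 2 * ‖f' y + M‖ ^ 2 := by
    have : 0 ≤ s / 2 * ‖f' y + M‖ ^ 2 := by positivity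
    nlinarith
  have h5 : s / 2 * ‖f' y - f' x‖ ^ 2 ≤ 1 / (2 * L) * ‖f' y - f' x‖ ^ 2 := by
    refine mul_le_mul_of_nonneg_right ?_ (sq_nonneg _)
    rw [div_le_div_iff₀ two_pos (by positivity)]
    linarith
  rw [h3] at h4
  linarith

theorem neg_mul_inner_sub_sq_le {s b : ℝ} (hb : 0 < b) (hbs : b ≤ s / 2) {r : ℝ} (hr : b ≤ r)
    (G g M : H) :
    -(s * b) * inner ℝ G g - s * r / 2 * ‖G - g‖ ^ 2 + s ^ 2 * inner ℝ G M
      ≤ s ^ 3 / (2 * b) * ‖M‖ ^ 2 - s * b / 2 * ‖g‖ ^ 2 := by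
  have hs : 0 < s := by linarith
  have h1 := norm_sub_sq_real G g
  have h2 := real_inner_le_norm G M
  have h3 : s * b / 2 * ‖G - g‖ ^ 2 ≤ s * r / 2 * ‖G - g‖ ^ 2 := by gcongr
  have h4 : s ^ 2 * (‖G‖ * ‖M‖) ≤ s * b / 2 * ‖G‖ ^ 2 + s ^ 3 / (2 * b) * ‖M‖ ^ 2 := by
    have : s * b / 2 * ‖G‖ ^ 2 + s ^ 3 / (2 * b) * ‖M‖ ^ 2 - s ^ 2 * (‖G‖ * ‖M‖)
      = s / (2 * b) * (b * ‖G‖ - s * ‖M‖) ^ 2 := by field_simp; ring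
    have h5 : 0 ≤ s / (2 * b) * (b * ‖G‖ - s * ‖M‖) ^ 2 := by positivity
    linarith
  have h5 : s ^ 2 * inner ℝ G M ≤ s ^ 2 * (‖G‖ * ‖M‖) := by gcongr
  rw [h1] at h3
  rw [h1]
  linarith

/-- One step of the Lyapunov analysis for `s t² (f x - min f) + ‖v‖² / 2`. -/
theorem igahd_lyapunov_step {s b t W W₁ : ℝ} (hb : 0 < b) (hbs : b ≤ s / 2) (ht : 2 ≤ t)
    {v v₁ G g y x xs e M : H}
    (hv : v₁ = v - (s * t) • G + e)
    (hv' : v₁ = (t - 1) • (y - x) + (y - xs) - (s * t) • G + (b * t) • g - (s * t) • M)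
    (hA : W₁ ≤ W + inner ℝ G (y - x) - s / 2 * ‖G‖ ^ 2 - s / 2 * ‖G - g‖ ^ 2 + s / 2 * ‖M‖ ^ 2)
    (hB : W₁ ≤ inner ℝ G (y - xs) - s / 2 * ‖G‖ ^ 2 + s / 2 * ‖M‖ ^ 2) :
    s * t ^ 2 * W₁ + ‖v₁‖ ^ 2 / 2 + s * b / 2 * t ^ 2 * ‖g‖ ^ 2 ≤
      s * (t * (t - 1)) * W + ‖v‖ ^ 2 / 2 + (s ^ 2 / 2 + s ^ 3 / (2 * b)) * t ^ 2 * ‖M‖ ^ 2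
        + ‖e‖ ^ 2 / 2 + ‖e‖ * ‖v‖ := by
  have hs : 0 < s := by linarith
  have h1 : ‖v₁‖ ^ 2 = ‖v‖ ^ 2 + s ^ 2 * t ^ 2 * ‖G‖ ^ 2 + ‖e‖ ^ 2 + 2 * inner ℝ e v
      - 2 * (s * t) * (inner ℝ G v + inner ℝ G e) := by
    rw [hv, norm_add_sq_real, norm_sub_sq_real, inner_sub_left, norm_smul, inner_smul_right,
      inner_smul_left, Real.norm_of_nonneg (by positivity), real_inner_comm v e,
      real_inner_comm v G]
    simp
    ring
  have h2 : inner ℝ G v + inner ℝ G e = (t - 1) * inner ℝ G (y - x) + inner ℝ G (y - xs)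
      + b * t * inner ℝ G g - s * t * inner ℝ G M := by
    have := congrArg (inner ℝ G) (hv.symm.trans hv')
    simp only [inner_add_right, inner_sub_right (𝕜 := ℝ) G _ (_ • _), inner_smul_right] at this
    linarith
  have h3 := real_inner_le_norm e v
  have hA' := mul_le_mul_of_nonneg_left hA (show 0 ≤ s * (t * (t - 1)) by
    have : 0 ≤ t - 1 := by linarith
    positivity)
  have hB' := mul_le_mul_of_nonneg_left hB (show 0 ≤ s * t by positivity)
  have h4 := mul_le_mul_of_nonneg_left
    (neg_mul_inner_sub_sq_le hb hbs (show b ≤ s * ((t - 1) / t) by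
      have : 1 / 2 ≤ (t - 1) / t := by
        rw [div_le_div_iff₀ two_pos (by linarith)]; linarith
      nlinarith) G g M) (sq_nonneg t)
  have h5 : t ^ 2 * (s * (s * ((t - 1) / t)) / 2 * ‖G - g‖ ^ 2)
      = s ^ 2 * (t * (t - 1)) / 2 * ‖G - g‖ ^ 2 := by field_simp
  rw [mul_add, mul_sub, h5] at h4
  rw [h1, h2]
  linarith

/-- One step of the energy analysis for `t² (s (f x - min f) + ‖d‖² / 2)`. -/
theorem igahd_energy_step {s b t τ W W₁ : ℝ} (hb : 0 < b) (hbs : b ≤ s / 2) (ht : 0 < t)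
    (hτ : 1 ≤ τ) {d d₁ G g g₀ y x e M : H}
    (hd : t • d₁ = (τ - 1) • d + (b • g₀ + e) - (s * t) • G)
    (hyx : t • (y - x) = (τ - 1) • d + (b • g₀ + e) + (s * t) • M - (t * b) • g)
    (hA : W₁ ≤ W + inner ℝ G (y - x) - s / 2 * ‖G‖ ^ 2 - s / 2 * ‖G - g‖ ^ 2
      + s / 2 * ‖M‖ ^ 2) :
    t ^ 2 * (s * W₁ + ‖d₁‖ ^ 2 / 2) + τ / 2 * ‖d‖ ^ 2 ≤
      s * t ^ 2 * W + τ ^ 2 * (‖d‖ ^ 2 / 2) + (τ + 1) * b ^ 2 * ‖g₀‖ ^ 2 + ‖e‖ ^ 2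
        + ‖e‖ * (τ * ‖d‖) + (s ^ 2 / 2 + s ^ 3 / (2 * b)) * t ^ 2 * ‖M‖ ^ 2 := by
  have hs : 0 < s := by linarith
  set r := b • g₀ + e with hr
  set q := (τ - 1) • d + r with hq
  have h1 : t ^ 2 * ‖d₁‖ ^ 2 = ‖q‖ ^ 2 - 2 * (s * t) * inner ℝ G q + s ^ 2 * t ^ 2 * ‖G‖ ^ 2 := by
    have : t ^ 2 * ‖d₁‖ ^ 2 = ‖t • d₁‖ ^ 2 := by
      rw [norm_smul, mul_pow, Real.norm_of_nonneg ht.le]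
    rw [this, hd, norm_sub_sq_real, inner_smul_right, norm_smul,
      Real.norm_of_nonneg (by positivity), real_inner_comm]
    ring
  have h2 : t * inner ℝ G (y - x) = inner ℝ G q + s * t * inner ℝ G M - t * b * inner ℝ G g := by
    rw [← inner_smul_right, hyx, inner_sub_right, inner_add_right, inner_smul_right,
      inner_smul_right]
  have hA' := mul_le_mul_of_nonneg_left hA (show 0 ≤ s * t ^ 2 by positivity)
  have h4 := mul_le_mul_of_nonneg_left
    (neg_mul_inner_sub_sq_le hb hbs (show b ≤ s by linarith) G g M) (sq_nonneg t)
  have h4' : 0 ≤ t ^ 2 * (s * b / 2 * ‖g‖ ^ 2) := by positivity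
  have h5 : s * t ^ 2 * inner ℝ G (y - x) = s * t * (t * inner ℝ G (y - x)) := by ring
  have h6 : ‖q‖ ^ 2 / 2 + τ / 2 * ‖d‖ ^ 2 ≤
      τ ^ 2 * (‖d‖ ^ 2 / 2) + (τ + 1) * b ^ 2 * ‖g₀‖ ^ 2 + ‖e‖ ^ 2 + ‖e‖ * (τ * ‖d‖) := by
    have hτ' : 0 ≤ τ - 1 := by linarith
    have hr1 : ‖r‖ ≤ b * ‖g₀‖ + ‖e‖ := by
      refine (norm_add_le _ _).trans ?_
      rw [norm_smul, Real.norm_of_nonneg hb.le]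
    have hq1 : ‖q‖ ≤ (τ - 1) * ‖d‖ + (b * ‖g₀‖ + ‖e‖) := by
      refine (norm_add_le _ _).trans ?_
      rw [norm_smul, Real.norm_of_nonneg hτ']
      linarith
    have hq2 : ‖q‖ ^ 2 ≤ ((τ - 1) * ‖d‖ + (b * ‖g₀‖ + ‖e‖)) ^ 2 := by gcongr
    have i1 := mul_nonneg hτ' (sq_nonneg (‖d‖ - b * ‖g₀‖))
    have i2 := sq_nonneg (b * ‖g₀‖ - ‖e‖)
    have i3 : 0 ≤ ‖e‖ * ‖d‖ := by positivity
    have i4 : 0 ≤ (τ + 1) * (b * ‖g₀‖) ^ 2 := by positivity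
    nlinarith
  rw [h2] at h5
  nlinarith

end

/-- The velocity recursion of the algorithm, rescaled by `t`. -/
theorem igahd_recursion {H : Type*} [AddCommGroup H] [Module ℝ H]
    {α m b s c t τ : ℝ} (ht : t = c * m) (hτ : τ = (c - 1) * m) (hc : c ≠ 0)
    (hm : (α - 1) * m = 1) {y x x₀ x₁ g g₀ N N₀ G M : H}
    (hy : y = x + (1 - α / c) • (x - x₀) - b • (g + N) + (b * (1 - 1 / c)) • (g₀ + N₀))
    (hx : x₁ = y - s • (G + M)) :
    t • (y - x) = (τ - 1) • (x - x₀ + b • g₀)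
        + (b • g₀ + ((b * τ) • N₀ - (b * t) • N - (s * t) • M)) + (s * t) • M - (t * b) • g ∧
      t • (x₁ - x + b • g) = (τ - 1) • (x - x₀ + b • g₀)
        + (b • g₀ + ((b * τ) • N₀ - (b * t) • N - (s * t) • M)) - (s * t) • G := by
  have h1 : t * (1 - α / c) = τ - 1 := by
    rw [ht, hτ]; field_simp; linarith
  have h2 : t * (1 - 1 / c) = τ := by
    rw [ht, hτ]; field_simp
  have h3 : t • (y - x) = (τ - 1) • (x - x₀) - (t * b) • (g + N) + (b * τ) • (g₀ + N₀) := by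
    rw [hy, ← h1, ← h2]
    module
  have h4 : t • (y - x) = (τ - 1) • (x - x₀ + b • g₀)
        + (b • g₀ + ((b * τ) • N₀ - (b * t) • N - (s * t) • M)) + (s * t) • M - (t * b) • g := by
    rw [h3]; module
  refine ⟨h4, ?_⟩
  have h5 : t • (x₁ - x + b • g) = t • (y - x) - (s * t) • (G + M) + (t * b) • g := by
    rw [hx]; module
  rw [h5, h4]
  module

theorem summable_sq_of_nonneg {u : ℕ → ℝ} (hu : ∀ n, 0 ≤ u n) (hs : Summable u) :
    Summable fun n => u n ^ 2 := by
  refine Summable.of_nonneg_of_le (fun n => sq_nonneg _) (fun n => ?_) (hs.mul_left (∑' n, u n))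
  rw [sq]
  exact mul_le_mul_of_nonneg_right (hs.le_tsum n fun j _ => hu j) (hu n)

theorem eq_zero_of_tendsto_of_summable_div {F : ℕ → ℝ} {l : ℝ} (hF : ∀ n, 0 ≤ F n)
    (hl : Tendsto F atTop (nhds l)) (hs : Summable fun n : ℕ => F n / n) : l = 0 := by
  by_contra hne
  have hl0 : 0 ≤ l := ge_of_tendsto' hl hF
  have hlpos : 0 < l := lt_of_le_of_ne hl0 (Ne.symm hne)
  obtain ⟨N, hN⟩ := eventually_atTop.1 (hl.eventually_const_le (half_lt_self hlpos))
  refine Real.not_summable_one_div_natCast ?_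
  rw [← summable_nat_add_iff N]
  refine Summable.of_nonneg_of_le (fun n => by positivity) (fun n => ?_)
    (((summable_nat_add_iff N).2 hs).mul_left (2 / l))
  rw [← mul_div_assoc]
  gcongr
  have := hN (n + N) (by lia)
  rw [div_mul_eq_mul_div, le_div_iff₀ hlpos]
  linarith

set_option maxHeartbeats 1000000 in
/-- Theorem 2.2(i): with constant step-size, `f(x_k) − min f = o(1/k²)`. -/
theorem igahd_values_little_o
    {H : Type*} [NormedAddCommGroup H] [InnerProductSpace ℝ H] [CompleteSpace H]
    (f : H → ℝ) (f' : H → H) (L : ℝ) (hL : 0 < L)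
    (hconv : ConvexOn ℝ Set.univ f)
    (hdiff : ∀ z, HasGradientAt f (f' z) z)
    (hlip : ∀ z w, ‖f' z - f' w‖ ≤ L * ‖z - w‖)
    (xstar : H) (hmin : ∀ z, f xstar ≤ f z)
    (α : ℝ) (hα : 3 < α)
    (s β : ℕ → ℝ) (hs0 : s 0 = 0) (hβ0 : β 0 = 0)
    -- constant step-size `s_k ≡ sc ∈ (0, 1/L]` and damping `β_k ≡ η √sc / 2`
    (sc : ℝ) (hsc_pos : 0 < sc) (hsc_le : sc ≤ 1 / L)
    (hs_const : ∀ k, 1 ≤ k → s k = sc)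
    (η : ℝ) (hη0 : 0 < η) (hη1 : η ≤ 1)
    (hβ : ∀ k, 1 ≤ k → β k = η * Real.sqrt sc / 2)
    (x y Mx My : ℕ → H)
    (hx_init : x 1 = x 0)
    (hy : ∀ k, 1 ≤ k → y k = x k + (1 - α / (k : ℝ)) • (x k - x (k - 1))
        - (β k * Real.sqrt (s k)) • (f' (x k) + Mx k)
        + (β (k - 1) * Real.sqrt (s (k - 1)) * (1 - 1 / (k : ℝ))) •
            (f' (x (k - 1)) + Mx (k - 1)))
    (hx : ∀ k, 1 ≤ k → x (k + 1) = y k - s k • (f' (y k) + My k))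
    (hJ0x : Summable fun k : ℕ => s k * (k : ℝ) * ‖Mx k‖)
    (hJ0y : Summable fun k : ℕ => s k * (k : ℝ) * ‖My k‖) :
    Tendsto (fun k : ℕ => (k : ℝ) ^ 2 * (f (x k) - f xstar)) atTop (nhds 0) := by
  have hα1 : 0 < α - 1 := by linarith
  obtain ⟨m, hmα⟩ : ∃ m, (α - 1) * m = 1 := ⟨(α - 1)⁻¹, mul_inv_cancel₀ hα1.ne'⟩
  have hm : 0 < m := by
    by_contra! h
    nlinarith
  have hm2 : m < 1 / 2 := by nlinarith
  obtain ⟨b, hbdef⟩ : ∃ b, b = η * sc / 2 := ⟨_, rfl⟩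
  have hb : 0 < b := by rw [hbdef]; positivity
  have hbs : b ≤ sc / 2 := by rw [hbdef]; nlinarith
  have hcoef : ∀ k, 1 ≤ k → β k * Real.sqrt (s k) = b := fun k hk => by
    rw [hβ k hk, hs_const k hk, hbdef]
    linear_combination η / 2 * Real.mul_self_sqrt hsc_pos.le
  obtain ⟨τ, hτdef⟩ : ∃ τ : ℕ → ℝ, ∀ n, τ n = n * m := ⟨fun n => n * m, fun _ => rfl⟩
  have hτsucc : ∀ n, τ (n + 1) = τ n + m := fun n => by
    rw [hτdef, hτdef]; push_cast; ring
  have hτ0 : ∀ n, 0 ≤ τ n := fun n => by rw [hτdef]; positivity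
  obtain ⟨e, he⟩ : ∃ e : ℕ → H, ∀ n, e n = (b * τ n) • Mx n - (b * τ (n + 1)) • Mx (n + 1)
    - (sc * τ (n + 1)) • My (n + 1) := ⟨_, fun _ => rfl⟩
  obtain ⟨d, hd⟩ : ∃ d : ℕ → H, ∀ n, d n = x (n + 1) - x n + b • f' (x n) := ⟨_, fun _ => rfl⟩
  obtain ⟨v, hv⟩ : ∃ v : ℕ → H, ∀ n, v n = x n - xstar + τ n • d n := ⟨_, fun _ => rfl⟩
  obtain ⟨W, hW⟩ : ∃ W : ℕ → ℝ, ∀ n, W n = f (x n) - f xstar := ⟨_, fun _ => rfl⟩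
  have hW0 : ∀ n, 0 ≤ W n := fun n => by rw [hW]; linarith [hmin (x n)]
  have hxstep : ∀ n, x (n + 1 + 1) = y (n + 1) - sc • (f' (y (n + 1)) + My (n + 1)) := fun n => by
    rw [hx (n + 1) (by lia), hs_const (n + 1) (by lia)]
  have hrec : ∀ n, 1 ≤ n →
      τ (n + 1) • (y (n + 1) - x (n + 1)) = (τ n - 1) • d n + (b • f' (x n) + e n)
        + (sc * τ (n + 1)) • My (n + 1) - (τ (n + 1) * b) • f' (x (n + 1)) ∧
      τ (n + 1) • d (n + 1) = (τ n - 1) • d n + (b • f' (x n) + e n)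
        - (sc * τ (n + 1)) • f' (y (n + 1)) := by
    intro n hn
    have hy' := hy (n + 1) (by lia)
    rw [Nat.add_sub_cancel, hcoef _ (by lia), hcoef _ hn] at hy'
    rw [he, hd, hd]
    refine igahd_recursion (c := ((n + 1 : ℕ) : ℝ)) (hτdef _) ?_ (by positivity) hmα hy' (hxstep n)
    rw [hτdef]; push_cast; ring
  have hgrad : f' xstar = 0 := by
    have hloc : IsLocalMin f xstar := Eventually.of_forall hmin
    simpa using hloc.hasFDerivAt_eq_zero (hdiff xstar).hasFDerivAt
  have hA : ∀ n, W (n + 1 + 1) ≤ W (n + 1) + inner ℝ (f' (y (n + 1))) (y (n + 1) - x (n + 1))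
      - sc / 2 * ‖f' (y (n + 1))‖ ^ 2 - sc / 2 * ‖f' (y (n + 1)) - f' (x (n + 1))‖ ^ 2
      + sc / 2 * ‖My (n + 1)‖ ^ 2 := by
    intro n
    have := hconv.inexact_gradient_step_le hL hsc_pos hsc_le hdiff hlip (x (n + 1)) (y (n + 1))
      (My (n + 1))
    rw [← hxstep] at this
    rw [hW, hW]
    linarith
  have hB : ∀ n, W (n + 1 + 1) ≤ inner ℝ (f' (y (n + 1))) (y (n + 1) - xstar)
      - sc / 2 * ‖f' (y (n + 1))‖ ^ 2 + sc / 2 * ‖My (n + 1)‖ ^ 2 := by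
    intro n
    have := hconv.inexact_gradient_step_le hL hsc_pos hsc_le hdiff hlip xstar (y (n + 1))
      (My (n + 1))
    rw [← hxstep, hgrad, sub_zero] at this
    have h2 : 0 ≤ sc / 2 * ‖f' (y (n + 1))‖ ^ 2 := by positivity
    rw [hW]
    linarith
  -- summability of the errors
  have hsum : ∀ M : ℕ → H, (Summable fun k : ℕ => s k * (k : ℝ) * ‖M k‖) →
      Summable fun n => τ n * ‖M n‖ := by
    intro M hM
    refine (hM.mul_left (m / sc)).congr fun n => ?_
    rcases Nat.eq_zero_or_pos n with rfl | hn
    · simp [hτdef]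
    · rw [hs_const n hn, hτdef]
      field_simp
  have hsx := hsum Mx hJ0x
  have hsy := (summable_nat_add_iff 1).2 (hsum My hJ0y)
  have hse : Summable fun n => ‖e n‖ := by
    refine Summable.of_nonneg_of_le (fun n => norm_nonneg _) (fun n => ?_)
      (((hsx.mul_left b).add (((summable_nat_add_iff 1).2 hsx).mul_left b)).add (hsy.mul_left sc))
    rw [he]
    refine (norm_sub_le _ _).trans (add_le_add ((norm_sub_le _ _).trans (add_le_add ?_ ?_)) ?_)
    all_goals
      rw [norm_smul, Real.norm_of_nonneg (mul_nonneg (by positivity) (hτ0 _)), mul_assoc]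
  have hse2 := summable_sq_of_nonneg (fun n => norm_nonneg (e n)) hse
  have hsy2 := summable_sq_of_nonneg (fun n => mul_nonneg (hτ0 _) (norm_nonneg _)) hsy
  obtain ⟨C, hC⟩ : ∃ C, C = sc ^ 2 / 2 + sc ^ 3 / (2 * b) := ⟨_, rfl⟩
  have hC0 : 0 ≤ C := by rw [hC]; positivity
  obtain ⟨N, hN⟩ : ∃ N : ℕ, ∀ n, N ≤ n → 1 ≤ n ∧ 2 ≤ τ n := by
    obtain ⟨N, hN⟩ := exists_nat_ge (2 / m)
    refine ⟨N + 1, fun n hn => ⟨by lia, ?_⟩⟩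
    have : (N : ℝ) ≤ n := by exact_mod_cast (by lia : N ≤ n)
    rw [hτdef, ← div_le_iff₀ hm]
    linarith
  have hδ : ∀ n, 0 ≤ C * (τ (n + 1) * ‖My (n + 1)‖) ^ 2 + ‖e n‖ ^ 2 + ‖e n‖ := fun n => by
    positivity
  have hδs : Summable fun n => C * (τ (n + 1) * ‖My (n + 1)‖) ^ 2 + ‖e n‖ ^ 2 + ‖e n‖ :=
    ((hsy2.mul_left C).add hse2).add hse
  -- first Lyapunov function
  have hlyap := summable_and_tendsto_of_le_add_mul_one_add (N := N)
    (a := fun n => sc * τ n ^ 2 * W (n + 1) + ‖v n‖ ^ 2 / 2)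
    (p := fun n => sc * ((1 - 2 * m) * τ (n + 1)) * W (n + 1)
      + sc * b / 2 * (τ (n + 1) ^ 2 * ‖f' (x (n + 1))‖ ^ 2))
    (fun n => by have := hW0 (n + 1); positivity)
    (fun n => by
      have := hW0 (n + 1)
      have := hτ0 (n + 1)
      have : 0 ≤ 1 - 2 * m := by linarith
      positivity) hδ hδs (by
    intro n hn
    obtain ⟨hn1, hn2⟩ := hN n hn
    obtain ⟨hr1, hr2⟩ := hrec n hn1
    have hv1 : v (n + 1) = v n - (sc * τ (n + 1)) • f' (y (n + 1)) + e n := by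
      rw [hv, hr2, hv]
      have : x (n + 1) = x n + d n - b • f' (x n) := by rw [hd]; abel
      rw [this]
      module
    have hv2 : v (n + 1) = (τ (n + 1) - 1) • (y (n + 1) - x (n + 1)) + (y (n + 1) - xstar)
        - (sc * τ (n + 1)) • f' (y (n + 1)) + (b * τ (n + 1)) • f' (x (n + 1))
        - (sc * τ (n + 1)) • My (n + 1) := by
      rw [hv, hd, hxstep]
      module
    have key := igahd_lyapunov_step hb hbs (by linarith [hτsucc n]) hv1 hv2 (hA n) (hB n)
    rw [← hC] at key
    have h1 : sc * (τ (n + 1) * (τ (n + 1) - 1)) * W (n + 1)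
        + sc * ((1 - 2 * m) * τ (n + 1)) * W (n + 1) ≤ sc * τ n ^ 2 * W (n + 1) := by
      rw [← add_mul, ← mul_add]
      refine mul_le_mul_of_nonneg_right (mul_le_mul_of_nonneg_left ?_ hsc_pos.le) (hW0 _)
      rw [hτsucc]
      nlinarith
    have h2 : ‖e n‖ * ‖v n‖ ≤ ‖e n‖ * (1 + (sc * τ n ^ 2 * W (n + 1) + ‖v n‖ ^ 2 / 2)) := by
      refine mul_le_mul_of_nonneg_left ?_ (norm_nonneg _)
      have := mul_nonneg (mul_nonneg hsc_pos.le (sq_nonneg (τ n))) (hW0 (n + 1))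
      nlinarith [sq_nonneg (‖v n‖ - 1)]
    have h3 : 0 ≤ (C * (τ (n + 1) * ‖My (n + 1)‖) ^ 2 + ‖e n‖ ^ 2)
        * (sc * τ n ^ 2 * W (n + 1) + ‖v n‖ ^ 2 / 2) := by
      have := hW0 (n + 1)
      positivity
    have h4 := sq_nonneg ‖e n‖
    linarith)
  have hp1 : Summable fun n => τ (n + 1) * W (n + 1) := by
    refine Summable.of_nonneg_of_le (fun n => mul_nonneg (hτ0 _) (hW0 _)) (fun n => ?_)
      (hlyap.1.mul_left (1 / (sc * (1 - 2 * m))))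
    have h1 : 0 < 1 - 2 * m := by linarith
    rw [one_div_mul_eq_div, le_div_iff₀ (by positivity)]
    have : 0 ≤ sc * b / 2 * (τ (n + 1) ^ 2 * ‖f' (x (n + 1))‖ ^ 2) := by positivity
    linarith
  have hp2 : Summable fun n => τ n ^ 2 * ‖f' (x n)‖ ^ 2 := by
    refine (summable_nat_add_iff 1).1 ?_
    refine Summable.of_nonneg_of_le (fun n => by positivity) (fun n => ?_)
      (hlyap.1.mul_left (1 / (sc * b / 2)))
    rw [one_div_mul_eq_div, le_div_iff₀ (by positivity)]
    have : 0 ≤ sc * ((1 - 2 * m) * τ (n + 1)) * W (n + 1) := by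
      have := hW0 (n + 1)
      have := hτ0 (n + 1)
      have : 0 ≤ 1 - 2 * m := by linarith
      positivity
    linarith
  -- second energy
  obtain ⟨hs3, l, hl⟩ := summable_and_tendsto_of_le_add_mul_one_add (N := N)
    (a := fun n => τ n ^ 2 * (sc * W (n + 1) + ‖d n‖ ^ 2 / 2))
    (p := fun n => τ n / 2 * ‖d n‖ ^ 2)
    (ε := fun n => (C * (τ (n + 1) * ‖My (n + 1)‖) ^ 2 + ‖e n‖ ^ 2 + ‖e n‖)
      + sc * (τ (n + 1) * W (n + 1)) + 2 * b ^ 2 * (τ n ^ 2 * ‖f' (x n)‖ ^ 2))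
    (fun n => by have := hW0 (n + 1); positivity)
    (fun n => by have := hτ0 n; positivity)
    (fun n => by
      have := hW0 (n + 1)
      have := hτ0 (n + 1)
      positivity)
    ((hδs.add (hp1.mul_left sc)).add (hp2.mul_left (2 * b ^ 2))) (by
    intro n hn
    obtain ⟨hn1, hn2⟩ := hN n hn
    obtain ⟨hr1, hr2⟩ := hrec n hn1
    have key := igahd_energy_step hb hbs (by linarith [hτsucc n]) (by linarith) hr2 hr1 (hA n)
    rw [← hC] at key
    have hWn := hW0 (n + 1)
    have hτn := hτ0 (n + 1)
    have h1 : sc * τ (n + 1) ^ 2 * W (n + 1)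
        ≤ τ n ^ 2 * (sc * W (n + 1)) + sc * (τ (n + 1) * W (n + 1)) := by
      have : τ (n + 1) ^ 2 ≤ τ n ^ 2 + τ (n + 1) := by
        rw [hτsucc]
        nlinarith
      have := mul_le_mul_of_nonneg_right this (mul_nonneg hsc_pos.le hWn)
      linarith
    have h2 : ‖e n‖ * (τ n * ‖d n‖)
        ≤ ‖e n‖ * (1 + τ n ^ 2 * (sc * W (n + 1) + ‖d n‖ ^ 2 / 2)) := by
      refine mul_le_mul_of_nonneg_left ?_ (norm_nonneg _)
      have := mul_nonneg (sq_nonneg (τ n)) (mul_nonneg hsc_pos.le hWn)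
      nlinarith [sq_nonneg (τ n * ‖d n‖ - 1)]
    have h3 : 0 ≤ (C * (τ (n + 1) * ‖My (n + 1)‖) ^ 2 + ‖e n‖ ^ 2 + sc * (τ (n + 1) * W (n + 1))
          + 2 * b ^ 2 * (τ n ^ 2 * ‖f' (x n)‖ ^ 2))
        * (τ n ^ 2 * (sc * W (n + 1) + ‖d n‖ ^ 2 / 2)) := by
      positivity
    have h4 : (τ n + 1) * b ^ 2 * ‖f' (x n)‖ ^ 2 ≤ 2 * b ^ 2 * (τ n ^ 2 * ‖f' (x n)‖ ^ 2) := by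
      have : τ n + 1 ≤ 2 * τ n ^ 2 := by nlinarith
      have := mul_le_mul_of_nonneg_right this (show 0 ≤ b ^ 2 * ‖f' (x n)‖ ^ 2 by positivity)
      linarith
    linarith)
  have hl0 : l = 0 := by
    refine eq_zero_of_tendsto_of_summable_div
      (fun n => mul_nonneg (sq_nonneg _) (by have := hW0 (n + 1); positivity)) hl ?_
    refine Summable.of_nonneg_of_le (fun n => by have := hW0 (n + 1); positivity) (fun n => ?_)
      (((hp1.mul_left sc).add hs3).mul_left m)
    rcases Nat.eq_zero_or_pos n with rfl | hn
    · have := hW0 1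
      have := hτ0 1
      have := hτ0 0
      simp only [Nat.cast_zero, div_zero, zero_add]
      positivity
    · have h1 : τ n ^ 2 * (sc * W (n + 1) + ‖d n‖ ^ 2 / 2) / n
          = m * (sc * (τ n * W (n + 1)) + τ n / 2 * ‖d n‖ ^ 2) := by
        rw [hτdef]
        field_simp
      have := hW0 (n + 1)
      rw [h1, hτsucc]
      gcongr
      linarith
  rw [hl0] at hl
  rw [← tendsto_add_atTop_iff_nat 1]
  refine squeeze_zero' (g := fun n => 4 / (sc * m ^ 2)
    * (τ n ^ 2 * (sc * W (n + 1) + ‖d n‖ ^ 2 / 2))) ?_ ?_ (by simpa using hl.const_mul _)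
  · exact Eventually.of_forall fun n => mul_nonneg (sq_nonneg _) (by rw [← hW]; exact hW0 _)
  · filter_upwards [eventually_ge_atTop 1] with n hn
    have hn' : (1 : ℝ) ≤ n := by exact_mod_cast hn
    have hWn := hW0 (n + 1)
    have h1 : 4 / (sc * m ^ 2) * (τ n ^ 2 * (sc * W (n + 1) + ‖d n‖ ^ 2 / 2))
        = 4 * n ^ 2 * W (n + 1) + 2 * n ^ 2 / sc * ‖d n‖ ^ 2 := by
      rw [hτdef]
      field_simp
      ring
    rw [h1, ← hW]
    have h2 : 0 ≤ 2 * (n : ℝ) ^ 2 / sc * ‖d n‖ ^ 2 := by positivity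
    have h3 : ((n + 1 : ℕ) : ℝ) ^ 2 ≤ 4 * (n : ℝ) ^ 2 := by
      push_cast
      nlinarith
    have := mul_le_mul_of_nonneg_right h3 hWn
    linarith
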